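/- For any SR instance with n ≥ 2 agents, every stable partition contains at most ⌊n/3⌋ + ((n mod 3) mod 2) cycles of odd length. -/

import Mathlib

/-- An SR instance with `n` agents. `rank i j` is the position (starting at 1) of
agent `j` in agent `i`'s preference list; by convention `rank i i = n`, encoding
that an agent prefers every other agent to itself. -/
structure SRInstance (n : ℕ) where
  rank : Fin n → Fin n → ℕ
  rank_self : ∀ i, rank i i = n
  rank_bijOn : ∀ i, Set.BijOn (rank i) {j | j ≠ i} (Set.Icc 1 (n - 1))

variable {n : ℕ}

/-- `M` is a matching, encoded as an involution; `M i = i` means `i` is unmatched. -/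
def IsMatching (M : Fin n → Fin n) : Prop := ∀ i, M (M i) = i

/-- The pair `{i, j}` blocks the matching `M`. -/
def Blocks (I : SRInstance n) (M : Fin n → Fin n) (i j : Fin n) : Prop :=
  i ≠ j ∧ (M i = i ∨ I.rank i j < I.rank i (M i)) ∧ (M j = j ∨ I.rank j i < I.rank j (M j))

def IsStableMatching (I : SRInstance n) (M : Fin n → Fin n) : Prop :=
  IsMatching M ∧ ∀ i j, ¬ Blocks I M i j

def Solvable (I : SRInstance n) : Prop := ∃ M, IsStableMatching I M

/-- A stable partition: (T1) every agent weakly prefers its successor to its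
predecessor, and (T2) no two distinct agents each strictly prefer the other to
their respective predecessors. -/
def IsStablePartition (I : SRInstance n) (σ : Equiv.Perm (Fin n)) : Prop :=
  (∀ a, I.rank a (σ a) ≤ I.rank a (σ⁻¹ a)) ∧
  ¬ ∃ i j : Fin n, i ≠ j ∧ I.rank i j < I.rank i (σ⁻¹ i) ∧ I.rank j i < I.rank j (σ⁻¹ j)

/-- The orbit (cycle) of `σ` containing `a`, as a finset. -/
def orbitOf (σ : Equiv.Perm (Fin n)) (a : Fin n) : Finset (Fin n) :=
  Finset.univ.filter (fun b => σ.SameCycle a b)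

/-- The number of cycles of odd length of the permutation `σ`. -/
def oddCycleCount (σ : Equiv.Perm (Fin n)) : ℕ :=
  ((Finset.univ.image (fun a => orbitOf σ a)).filter (fun s => Odd s.card)).card

/-- The cycle of `σ` at `a`, recorded as its orbit together with the cyclic
permutation induced on it (identity off the orbit). -/
def cycleAt (σ : Equiv.Perm (Fin n)) (a : Fin n) : Finset (Fin n) × Equiv.Perm (Fin n) :=
  (orbitOf σ a, σ.cycleOf a)

/-- The stable cycles of `I`: cycles occurring in some stable partition of `I`. -/
def stableCycles (I : SRInstance n) : Set (Finset (Fin n) × Equiv.Perm (Fin n)) :=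
  {c | ∃ (σ : Equiv.Perm (Fin n)) (a : Fin n), IsStablePartition I σ ∧ cycleAt σ a = c}

/-- The reduced stable cycles of `I`: stable cycles of length 2 or of odd length. -/
def reducedStableCycles (I : SRInstance n) : Set (Finset (Fin n) × Equiv.Perm (Fin n)) :=
  {c | c ∈ stableCycles I ∧ (c.1.card = 2 ∨ Odd c.1.card)}

theorem mem_orbitOf {σ : Equiv.Perm (Fin n)} {a b : Fin n} :
    b ∈ orbitOf σ a ↔ σ.SameCycle a b := by
  simp [orbitOf]

theorem orbitOf_eq_iff {σ : Equiv.Perm (Fin n)} {a b : Fin n} :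
    orbitOf σ b = orbitOf σ a ↔ σ.SameCycle a b := by
  refine ⟨fun h => mem_orbitOf.1 (h ▸ mem_orbitOf.2 (.refl σ b)), fun h => ?_⟩
  ext c
  rw [mem_orbitOf, mem_orbitOf]
  exact ⟨h.trans, h.symm.trans⟩

/-- The cycle lengths of a permutation add up to the number of points. -/
theorem sum_card_orbits (σ : Equiv.Perm (Fin n)) :
    ∑ s ∈ Finset.univ.image (orbitOf σ), s.card = n := by
  have h := Finset.card_eq_sum_card_image (orbitOf σ) Finset.univ
  rw [Finset.card_univ, Fintype.card_fin] at h
  refine Eq.trans (Finset.sum_congr rfl fun s hs => ?_) h.symm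
  obtain ⟨a, -, rfl⟩ := Finset.mem_image.1 hs
  congr 1
  ext b
  simp [orbitOf_eq_iff, mem_orbitOf]

/-- The number of odd cycles has the parity of the number of points. -/
theorem odd_oddCycleCount_iff (σ : Equiv.Perm (Fin n)) : Odd (oddCycleCount σ) ↔ Odd n := by
  conv_rhs => rw [← sum_card_orbits σ]
  exact (Finset.odd_sum_iff_odd_card_odd _).symm

theorem SRInstance.rank_lt (I : SRInstance n) {i j : Fin n} (h : j ≠ i) : I.rank i j < n := by
  have := (Set.mem_Icc.1 ((I.rank_bijOn i).mapsTo h)).2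
  have := i.pos
  omega

/-- A stable partition has at most one fixed point. -/
theorem IsStablePartition.eq_of_fixed {I : SRInstance n} {σ : Equiv.Perm (Fin n)}
    (hσ : IsStablePartition I σ) {a b : Fin n} (ha : σ a = a) (hb : σ b = b) : a = b := by
  by_contra hab
  refine hσ.2 ⟨a, b, hab, ?_, ?_⟩
  · rw [Equiv.Perm.inv_eq_iff_eq.2 ha.symm, I.rank_self]
    exact I.rank_lt (Ne.symm hab)
  · rw [Equiv.Perm.inv_eq_iff_eq.2 hb.symm, I.rank_self]
    exact I.rank_lt hab

theorem apply_eq_self_of_card_orbitOf_eq_one {σ : Equiv.Perm (Fin n)} {a : Fin n}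
    (h : (orbitOf σ a).card = 1) : σ a = a :=
  Finset.card_le_one.1 h.le _ (mem_orbitOf.2 ⟨1, by simp⟩) _ (mem_orbitOf.2 (.refl σ a))

/-- All odd cycles of a stable partition but at most one have length at least three. -/
theorem IsStablePartition.three_mul_oddCycleCount_le {I : SRInstance n}
    {σ : Equiv.Perm (Fin n)} (hσ : IsStablePartition I σ) : 3 * oddCycleCount σ ≤ n + 2 := by
  set O := (Finset.univ.image (orbitOf σ)).filter (fun s => Odd s.card) with hO
  have hle : ∑ s ∈ O, s.card ≤ n :=
    (Finset.sum_le_sum_of_subset (Finset.filter_subset _ _)).trans_eq (sum_card_orbits σ)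
  have hone : (O.filter (fun s => s.card = 1)).card ≤ 1 := by
    refine Finset.card_le_one.2 fun s hs t ht => ?_
    simp only [hO, Finset.mem_filter, Finset.mem_image, Finset.mem_univ, true_and] at hs ht
    obtain ⟨⟨⟨a, rfl⟩, -⟩, ha⟩ := hs
    obtain ⟨⟨⟨b, rfl⟩, -⟩, hb⟩ := ht
    rw [hσ.eq_of_fixed (apply_eq_self_of_card_orbitOf_eq_one ha)
      (apply_eq_self_of_card_orbitOf_eq_one hb)]
  have hsum : ∑ _s ∈ O, 3 ≤ ∑ s ∈ O, (s.card + 2 * if s.card = 1 then 1 else 0) := by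
    refine Finset.sum_le_sum fun s hs => ?_
    obtain ⟨k, hk⟩ := (Finset.mem_filter.1 hs).2
    split_ifs <;> omega
  rw [Finset.sum_add_distrib, ← Finset.mul_sum, ← Finset.card_filter, Finset.sum_const,
    smul_eq_mul] at hsum
  change 3 * O.card ≤ n + 2
  omega

/-- Every stable partition of an SR instance with `n ≥ 2` agents
contains at most `⌊n/3⌋ + ((n mod 3) mod 2)` cycles of odd length. -/
theorem stable_partition_odd_cycle_upper_bound {n : ℕ} (hn : 2 ≤ n) (I : SRInstance n)
    (σ : Equiv.Perm (Fin n)) (hσ : IsStablePartition I σ) :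
    oddCycleCount σ ≤ n / 3 + (n % 3) % 2 := by
  have hle := hσ.three_mul_oddCycleCount_le
  have hodd := odd_oddCycleCount_iff σ
  rw [Nat.odd_iff, Nat.odd_iff] at hodd
  omega
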